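/- arXiv:1101.3420 — 2 statements merged into one kernel-verified Lean document; each statement's English description precedes it below -/
import Mathlib

section
/- If the ap-basic class [x]_ap is maximal for the order <_ap (i.e. an ap-quasiattractor), then for every z ∈ M, x <_ap z if and only if z ∈ [x]_ap. In particular, every ap-quasiattractor [x]_ap is compact. -/
open MeasureTheory ProbabilityTheory Metric Set Filter Topology
open scoped ENNReal NNReal

noncomputable section

namespace QSDPaper

variable {d : ℕ}

/-- An absorption-preserving (ap) `δ`-pseudoorbit `ξ_0, …, ξ_n` in `M`. -/
def IsApOrbit (F : (Fin d → ℝ) → Fin d → ℝ) (M M0 : Set (Fin d → ℝ)) (δ : ℝ)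
    (n : ℕ) (ξ : ℕ → Fin d → ℝ) : Prop :=
  1 ≤ n ∧ (∀ i ≤ n, ξ i ∈ M) ∧ (∀ i < n, ξ i ∈ M0 → ξ (i + 1) ∈ M0) ∧
    ∀ i < n, dist (ξ (i + 1)) (F (ξ i)) < δ

/-- `x <_ap y`: for every `δ > 0` there is an ap `δ`-pseudoorbit joining `x` to `y`. -/
def apLe (F : (Fin d → ℝ) → Fin d → ℝ) (M M0 : Set (Fin d → ℝ)) (x y : Fin d → ℝ) : Prop :=
  ∀ δ > (0 : ℝ), ∃ n ξ, IsApOrbit F M M0 δ n ξ ∧ ξ 0 = x ∧ ξ n = y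

/-- `x ∼_ap y`. -/
def apEquiv (F : (Fin d → ℝ) → Fin d → ℝ) (M M0 : Set (Fin d → ℝ)) (x y : Fin d → ℝ) : Prop :=
  apLe F M M0 x y ∧ apLe F M M0 y x

/-- The set `R_ap` of ap-chain recurrent points. -/
def apRec (F : (Fin d → ℝ) → Fin d → ℝ) (M M0 : Set (Fin d → ℝ)) : Set (Fin d → ℝ) :=
  {x | apEquiv F M M0 x x}

/-- The ap-basic class of `x`. -/
def apClass (F : (Fin d → ℝ) → Fin d → ℝ) (M M0 : Set (Fin d → ℝ)) (x : Fin d → ℝ) :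
    Set (Fin d → ℝ) :=
  {y | y ∈ apRec F M M0 ∧ apEquiv F M M0 x y}

/-- `[x]_ap` is a maximal ap-basic class. -/
def IsApQuasiattractor (F : (Fin d → ℝ) → Fin d → ℝ) (M M0 : Set (Fin d → ℝ))
    (x : Fin d → ℝ) : Prop :=
  x ∈ apRec F M M0 ∧ ∀ y ∈ apRec F M M0, apLe F M M0 x y → apEquiv F M M0 x y

/-- A compact set `A` is an attractor for `F : M → M`. -/
def IsAttractor (F : (Fin d → ℝ) → Fin d → ℝ) (M A : Set (Fin d → ℝ)) : Prop :=
  IsCompact A ∧ A ⊆ M ∧ ∃ U : Set (Fin d → ℝ), IsOpen U ∧ A ⊆ U ∧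
    (⋂ n ∈ {k : ℕ | 1 ≤ k}, F^[n] '' (U ∩ M)) = A ∧
    ∀ V : Set (Fin d → ℝ), IsOpen V → A ⊆ V → ∃ N : ℕ, ∀ n ≥ N, F^[n] '' (U ∩ M) ⊆ V

/-- The ω-limit set of `x` under `F`. -/
def omegaSet (F : (Fin d → ℝ) → Fin d → ℝ) (x : Fin d → ℝ) : Set (Fin d → ℝ) :=
  {y | ∃ φ : ℕ → ℕ, StrictMono φ ∧ Tendsto (fun k => F^[φ k] x) atTop (𝓝 y)}

/-- The nonwandering set of `F` on `M`. -/
def nonwanderingSet (F : (Fin d → ℝ) → Fin d → ℝ) (M : Set (Fin d → ℝ)) :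
    Set (Fin d → ℝ) :=
  {x ∈ M | ∀ U : Set (Fin d → ℝ), IsOpen U → x ∈ U → ∀ N : ℕ,
    ∃ n ≥ N, ((F^[n] '' (U ∩ M)) ∩ (U ∩ M)).Nonempty}

/-- `β_δ(ε) = sup_{x ∈ M} p^ε(x, M \ N^δ(F x))`. -/
def beta (p : ℝ → Kernel (Fin d → ℝ) (Fin d → ℝ)) (F : (Fin d → ℝ) → Fin d → ℝ)
    (M : Set (Fin d → ℝ)) (δ ε : ℝ) : ℝ≥0∞ :=
  ⨆ x ∈ M, p ε x (M \ ball (F x) δ)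

/-- `μ` is a quasi-stationary distribution for `κ` on `M1` with eigenvalue `lam ∈ (0,1)`. -/
def IsQSD (κ : Kernel (Fin d → ℝ) (Fin d → ℝ)) (M1 : Set (Fin d → ℝ))
    (μ : Measure (Fin d → ℝ)) (lam : ℝ) : Prop :=
  IsProbabilityMeasure μ ∧ μ M1 = 1 ∧ 0 < lam ∧ lam < 1 ∧
    ∀ Γ : Set (Fin d → ℝ), MeasurableSet Γ → Γ ⊆ M1 →
      ∫⁻ x in M1, κ x Γ ∂μ = ENNReal.ofReal lam * μ Γ

/-- Weak* convergence of a sequence of measures (tested against bounded continuous functions). -/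
def WeaklyTendsto (μs : ℕ → Measure (Fin d → ℝ)) (μ : Measure (Fin d → ℝ)) : Prop :=
  ∀ g : BoundedContinuousFunction (Fin d → ℝ) ℝ,
    Tendsto (fun n => ∫ x, g x ∂μs n) atTop (𝓝 (∫ x, g x ∂μ))

/-- `stayProb κ V n x = P_x[X_0, …, X_n ∈ V] = P_x[τ_V > n]` for the Markov chain with
transition kernel `κ` started at `x`, where `τ_V = min {n : X_n ∉ V}`. -/
def stayProb (κ : Kernel (Fin d → ℝ) (Fin d → ℝ)) (V : Set (Fin d → ℝ)) :
    ℕ → (Fin d → ℝ) → ℝ≥0∞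
  | 0, x => V.indicator 1 x
  | n + 1, x => V.indicator (fun z => ∫⁻ y, stayProb κ V n y ∂κ z) x

/-- `tubeProb κ η n ξ x = P_x[dist (X_j, ξ_j) < η for j = 1, …, n]` for the Markov chain
with transition kernel `κ` started at `x`. -/
def tubeProb (κ : Kernel (Fin d → ℝ) (Fin d → ℝ)) (η : ℝ) :
    ℕ → (ℕ → Fin d → ℝ) → (Fin d → ℝ) → ℝ≥0∞
  | 0, _, _ => 1
  | n + 1, ξ, x => ∫⁻ y in ball (ξ 1) η, tubeProb κ η n (fun k => ξ (k + 1)) y ∂κ x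

/-- `A_n(ξ) = Σ_{i<n} ρ(ξ_i, ξ_{i+1})`. -/
def rhoCost (ρ : (Fin d → ℝ) → (Fin d → ℝ) → ℝ≥0∞) (n : ℕ) (ξ : ℕ → Fin d → ℝ) : ℝ≥0∞ :=
  ∑ i ∈ Finset.range n, ρ (ξ i) (ξ (i + 1))

/-- `B_ρ(x,y)`: minimal cost of a finite path in `M` from `x` to `y`. -/
def Brho (ρ : (Fin d → ℝ) → (Fin d → ℝ) → ℝ≥0∞) (M : Set (Fin d → ℝ))
    (x y : Fin d → ℝ) : ℝ≥0∞ :=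
  ⨅ (n : ℕ) (_ : 1 ≤ n) (ξ : ℕ → Fin d → ℝ)
    (_ : (∀ i ≤ n, ξ i ∈ M) ∧ ξ 0 = x ∧ ξ n = y), rhoCost ρ n ξ

/-- `x <_ρ y`. -/
def rhoLe (ρ : (Fin d → ℝ) → (Fin d → ℝ) → ℝ≥0∞) (M : Set (Fin d → ℝ))
    (x y : Fin d → ℝ) : Prop :=
  Brho ρ M x y = 0

/-- `x ∼_ρ y`. -/
def rhoEquiv (ρ : (Fin d → ℝ) → (Fin d → ℝ) → ℝ≥0∞) (M : Set (Fin d → ℝ))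
    (x y : Fin d → ℝ) : Prop :=
  rhoLe ρ M x y ∧ rhoLe ρ M y x

/-- The ρ-chain recurrent set `R_ρ`. -/
def rhoRec (ρ : (Fin d → ℝ) → (Fin d → ℝ) → ℝ≥0∞) (M : Set (Fin d → ℝ)) :
    Set (Fin d → ℝ) :=
  {x | rhoEquiv ρ M x x}

/-- The ρ-basic class of `x`. -/
def rhoClass (ρ : (Fin d → ℝ) → (Fin d → ℝ) → ℝ≥0∞) (M : Set (Fin d → ℝ))
    (x : Fin d → ℝ) : Set (Fin d → ℝ) :=
  {y | y ∈ rhoRec ρ M ∧ rhoEquiv ρ M x y}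

/-- `[x]_ρ` is a maximal ρ-basic class. -/
def IsRhoQuasiattractor (ρ : (Fin d → ℝ) → (Fin d → ℝ) → ℝ≥0∞) (M : Set (Fin d → ℝ))
    (x : Fin d → ℝ) : Prop :=
  x ∈ rhoRec ρ M ∧ ∀ y ∈ rhoRec ρ M, rhoLe ρ M x y → rhoEquiv ρ M x y

/-- Properties (i)–(iii) of Hypothesis 2.4 for the rate function `ρ`. -/
def HypRho (F : (Fin d → ℝ) → Fin d → ℝ) (M M0 : Set (Fin d → ℝ))
    (ρ : (Fin d → ℝ) → (Fin d → ℝ) → ℝ≥0∞) : Prop :=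
  ContinuousOn (fun q : (Fin d → ℝ) × (Fin d → ℝ) => ρ q.1 q.2) ((M \ M0) ×ˢ M) ∧
  (∀ x ∈ M, ∀ y ∈ M, (ρ x y = 0 ↔ y = F x)) ∧
  (∀ β : ℝ, 0 < β → ∃ c : ℝ≥0∞, 0 < c ∧ ∀ x ∈ M, ∀ y ∈ M, β < dist (F x) y → c ≤ ρ x y)

/-- Property (iv) of Hypothesis 2.4: large deviation upper and lower bounds. -/
def HypLD (p : ℝ → Kernel (Fin d → ℝ) (Fin d → ℝ)) (F : (Fin d → ℝ) → Fin d → ℝ)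
    (M M0 : Set (Fin d → ℝ)) (ρ : (Fin d → ℝ) → (Fin d → ℝ) → ℝ≥0∞) : Prop :=
  (∀ K : Set (Fin d → ℝ), IsCompact K → K ⊆ M \ M0 → ∀ z : Fin d → ℝ, ∀ r > (0 : ℝ),
    ∀ η > (0 : ℝ), ∀ᶠ ε : ℝ in 𝓝[>] (0 : ℝ), ∀ x ∈ K,
      -(((⨅ y ∈ ball z r ∩ M, ρ x y : ℝ≥0∞) : EReal)) - (η : EReal)
        ≤ (ε : EReal) * ENNReal.log (p ε x (ball z r ∩ M))) ∧
  (∀ C : Set (Fin d → ℝ), IsClosed C → C ⊆ M → ∀ η > (0 : ℝ),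
    ∀ᶠ ε : ℝ in 𝓝[>] (0 : ℝ), ∀ x ∈ M,
      (ε : EReal) * ENNReal.log (p ε x C) + ((⨅ y ∈ C, ρ x y : ℝ≥0∞) : EReal) ≤ (η : EReal))

/-- Hypothesis 2.5: absorption is not too unlikely near the absorbing set. -/
def HypAbs (p : ℝ → Kernel (Fin d → ℝ) (Fin d → ℝ)) (M M0 : Set (Fin d → ℝ)) : Prop :=
  ∀ c > (0 : ℝ), ∃ V0 : Set (Fin d → ℝ), IsOpen V0 ∧ M0 ⊆ V0 ∧
    (-(c : EReal)) ≤
      Filter.liminf (fun ε : ℝ => ⨅ x ∈ V0 ∩ M, (ε : EReal) * ENNReal.log (p ε x M0))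
        (𝓝[>] (0 : ℝ))

/-- The (topological) support of a measure. -/
def measSupport (μ : Measure (Fin d → ℝ)) : Set (Fin d → ℝ) :=
  {x | ∀ U : Set (Fin d → ℝ), IsOpen U → x ∈ U → 0 < μ U}

def apStep (F : (Fin d → ℝ) → Fin d → ℝ) (M M0 : Set (Fin d → ℝ)) (δ : ℝ)
    (a b : Fin d → ℝ) : Prop :=
  a ∈ M ∧ b ∈ M ∧ (a ∈ M0 → b ∈ M0) ∧ dist b (F a) < δ

theorem apLe_iff (F : (Fin d → ℝ) → Fin d → ℝ) (M M0 : Set (Fin d → ℝ)) (x y : Fin d → ℝ) :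
    apLe F M M0 x y ↔ ∀ δ > (0 : ℝ), Relation.TransGen (apStep F M M0 δ) x y := by
  constructor
  · intro h δ hδ
    obtain ⟨n, ξ, ⟨h1, h2, h3, h4⟩, rfl, rfl⟩ := h δ hδ
    have key : ∀ m, m + 1 ≤ n → Relation.TransGen (apStep F M M0 δ) (ξ 0) (ξ (m + 1)) := by
      intro m
      induction m with
      | zero =>
        intro hm
        exact .single ⟨h2 _ (by omega), h2 _ hm, h3 0 (by omega), h4 0 (by omega)⟩
      | succ m ih =>
        intro hm
        exact (ih (by omega)).tail ⟨h2 _ (by omega), h2 _ hm, h3 _ (by omega), h4 _ (by omega)⟩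
    obtain ⟨m, rfl⟩ : ∃ m, n = m + 1 := ⟨n - 1, by omega⟩
    exact key m le_rfl
  · intro h δ hδ
    replace h := h δ hδ
    induction h with
    | single h =>
      rename_i b
      refine ⟨1, fun i => if i = 0 then x else b, ⟨le_rfl, ?_, ?_, ?_⟩, by simp, by simp⟩
      · intro i hi
        by_cases h0 : i = 0
        · simpa [h0] using h.1
        · simpa [h0] using h.2.1
      · intro i hi
        obtain rfl : i = 0 := by omega
        simpa using h.2.2.1
      · intro i hi
        obtain rfl : i = 0 := by omega
        simpa using h.2.2.2
    | tail _ h ih =>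
      rename_i b c _
      obtain ⟨n, ξ, ⟨h1, h2, h3, h4⟩, e0, en⟩ := ih
      refine ⟨n + 1, fun i => if i ≤ n then ξ i else c, ⟨by omega, ?_, ?_, ?_⟩,
        by simpa using e0, by simp⟩
      · intro i hi
        by_cases h0 : i ≤ n
        · simpa [h0] using h2 i h0
        · simpa [h0] using h.2.1
      · intro i hi
        by_cases h0 : i < n
        · simpa [h0.le, Nat.succ_le_of_lt h0] using h3 i h0
        · obtain rfl : i = n := by omega
          simpa [en] using h.2.2.1
      · intro i hi
        by_cases h0 : i < n
        · simpa [h0.le, Nat.succ_le_of_lt h0] using h4 i h0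
        · obtain rfl : i = n := by omega
          simpa [en] using h.2.2.2

theorem apLe.trans' {F : (Fin d → ℝ) → Fin d → ℝ} {M M0 : Set (Fin d → ℝ)} {x y z : Fin d → ℝ}
    (h : apLe F M M0 x y) (h' : apLe F M M0 y z) : apLe F M M0 x z := by
  rw [apLe_iff] at *
  exact fun δ hδ => (h δ hδ).trans (h' δ hδ)

theorem step_M0 {F : (Fin d → ℝ) → Fin d → ℝ} {M M0 : Set (Fin d → ℝ)} {δ : ℝ}
    {x y : Fin d → ℝ} (h : Relation.TransGen (apStep F M M0 δ) x y) (hx : x ∈ M0) : y ∈ M0 := by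
  induction h with
  | single h => exact h.2.2.1 hx
  | tail _ h ih => exact h.2.2.1 ih

theorem apLe_M0 {F : (Fin d → ℝ) → Fin d → ℝ} {M M0 : Set (Fin d → ℝ)} {x y : Fin d → ℝ}
    (h : apLe F M M0 x y) (hx : x ∈ M0) : y ∈ M0 :=
  step_M0 ((apLe_iff _ _ _ _ _).1 h 1 one_pos) hx

theorem orbit_chain {F : (Fin d → ℝ) → Fin d → ℝ} {M M0 : Set (Fin d → ℝ)}
    (hFmap : MapsTo F M M) (hFM0 : MapsTo F M0 M0) {w : Fin d → ℝ} (hw : w ∈ M) {δ : ℝ}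
    (hδ : 0 < δ) {m n : ℕ} (hmn : m ≤ n) :
    Relation.ReflTransGen (apStep F M M0 δ) (F^[m] w) (F^[n] w) := by
  induction n, hmn using Nat.le_induction with
  | base => exact .refl
  | succ n hn ih =>
    refine ih.tail ?_
    rw [Function.iterate_succ_apply']
    have h1 : F^[n] w ∈ M := hFmap.iterate n hw
    exact ⟨h1, hFmap h1, fun h => hFM0 h, by simpa using hδ⟩

theorem exists_omega {F : (Fin d → ℝ) → Fin d → ℝ} {M M0 : Set (Fin d → ℝ)}
    (hMcl : IsClosed M) (hM0cl : IsClosed M0)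
    (hFmap : MapsTo F M M) (hFcont : ContinuousOn F M)
    (hFbdd : ∃ C : ℝ, ∀ x ∈ M, ‖F x‖ ≤ C)
    (hFM0 : MapsTo F M0 M0) (hFM1 : MapsTo F (M \ M0) (M \ M0)) {w : Fin d → ℝ} (hw : w ∈ M) :
    ∃ y ∈ M, (w ∈ M0 → y ∈ M0) ∧ apLe F M M0 w y ∧ ((w ∈ M0 ∨ y ∉ M0) → apLe F M M0 y y) := by
  obtain ⟨C, hC⟩ := hFbdd
  have horb : ∀ n, F^[n] w ∈ M := fun n => hFmap.iterate n hw
  obtain ⟨y, -, φ, hφ, hlim⟩ := (isCompact_closedBall (0 : Fin d → ℝ) C).tendsto_subseq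
    (x := fun n => F^[n + 1] w) (fun n => by
      rw [Function.iterate_succ_apply']
      simpa using hC _ (horb n))
  have hyM : y ∈ M := hMcl.mem_of_tendsto hlim (Eventually.of_forall fun k => horb _)
  have hback : ∀ n, F^[n] w ∈ M0 → w ∈ M0 := by
    intro n hn
    by_contra hw0
    exact (hFM1.iterate n ⟨hw, hw0⟩).2 hn
  have hy0 : w ∈ M0 → y ∈ M0 := fun h =>
    hM0cl.mem_of_tendsto hlim (Eventually.of_forall fun k => hFM0.iterate _ h)
  have hclose : ∀ δ > 0, ∀ᶠ k in atTop, apStep F M M0 δ (F^[φ k] w) y := by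
    intro δ hδ
    filter_upwards [Metric.tendsto_nhds.1 hlim δ hδ] with k hk
    refine ⟨horb _, hyM, fun h => hy0 (hback _ h), ?_⟩
    rw [dist_comm]
    simpa [Function.iterate_succ_apply'] using hk
  refine ⟨y, hyM, hy0, ?_, ?_⟩
  · rw [apLe_iff]
    intro δ hδ
    obtain ⟨k, hk⟩ := (hclose δ hδ).exists
    exact Relation.TransGen.tail' (orbit_chain hFmap hFM0 hw hδ (Nat.zero_le _)) hk
  · intro hor
    rw [apLe_iff]
    intro δ hδ
    have hlim2 : Tendsto (fun k => F (F^[φ k + 1] w)) atTop (𝓝 (F y)) :=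
      (hFcont y hyM).tendsto.comp
        (tendsto_nhdsWithin_iff.2 ⟨hlim, Eventually.of_forall fun k => horb _⟩)
    obtain ⟨k, hk⟩ := (Metric.tendsto_nhds.1 hlim2 δ hδ).exists
    obtain ⟨l, hl, hl2⟩ := ((hclose δ hδ).and
      (hφ.tendsto_atTop.eventually_ge_atTop (φ k + 2))).exists
    have h1 : apStep F M M0 δ y (F^[φ k + 2] w) := by
      refine ⟨hyM, horb _, fun h => ?_, ?_⟩
      · rcases hor with h' | h'
        · exact hFM0.iterate _ h'
        · exact absurd h h'
      · rw [Function.iterate_succ_apply']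
        exact hk
    exact Relation.TransGen.head' h1 ((orbit_chain hFmap hFM0 hw hδ hl2).tail hl)

theorem stmt5 (d : ℕ) (M M0 : Set (Fin d → ℝ)) (F : (Fin d → ℝ) → Fin d → ℝ)
    (hMcl : IsClosed M) (hM0cl : IsClosed M0) (hM0M : M0 ⊆ M)
    (hFmap : MapsTo F M M) (hFcont : ContinuousOn F M)
    (hFbdd : ∃ C : ℝ, ∀ x ∈ M, ‖F x‖ ≤ C)
    (hFM0 : MapsTo F M0 M0) (hFM1 : MapsTo F (M \ M0) (M \ M0))
    (x : Fin d → ℝ) (hx : IsApQuasiattractor F M M0 x) :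
    (∀ z ∈ M, (apLe F M M0 x z ↔ z ∈ apClass F M M0 x)) ∧
    IsCompact (apClass F M M0 x) := by
  have hfirst : ∀ z ∈ M, (apLe F M M0 x z ↔ z ∈ apClass F M M0 x) := by
    intro z hz
    refine ⟨fun hxz => ?_, fun h => h.2.1⟩
    have key : ∃ y, apLe F M M0 z y ∧ apLe F M M0 y y := by
      obtain ⟨y, hyM, -, hzy, hyy⟩ := exists_omega hMcl hM0cl hFmap hFcont hFbdd hFM0 hFM1 hz
      by_cases hy0 : y ∈ M0
      · obtain ⟨y2, -, -, h1, h2⟩ :=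
          exists_omega hMcl hM0cl hFmap hFcont hFbdd hFM0 hFM1 hyM
        exact ⟨y2, hzy.trans' h1, h2 (Or.inl hy0)⟩
      · exact ⟨y, hzy, hyy (Or.inr hy0)⟩
    obtain ⟨y, hzy, hyy⟩ := key
    have hyx := (hx.2 y ⟨hyy, hyy⟩ (hxz.trans' hzy)).2
    have hzx := hzy.trans' hyx
    have hzz := hzx.trans' hxz
    exact ⟨⟨hzz, hzz⟩, hxz, hzx⟩
  refine ⟨hfirst, ?_⟩
  have hlast : ∀ y ∈ apClass F M M0 x, ∀ δ > 0, ∃ b,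
      Relation.ReflTransGen (apStep F M M0 δ) x b ∧ apStep F M M0 δ b y := by
    intro y hy δ hδ
    exact Relation.TransGen.tail'_iff.1 ((apLe_iff _ _ _ _ _).1 hy.2.1 δ hδ)
  apply Metric.isCompact_of_isClosed_isBounded
  · rw [← isSeqClosed_iff_isClosed]
    intro u y hu hlim
    have huM : ∀ k, u k ∈ M := fun k => by
      obtain ⟨b, -, hb⟩ := hlast _ (hu k) 1 one_pos
      exact hb.2.1
    have hyM : y ∈ M := hMcl.mem_of_tendsto hlim (Eventually.of_forall huM)
    refine (hfirst y hyM).1 ((apLe_iff _ _ _ _ _).2 fun δ hδ => ?_)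
    obtain ⟨k, hk⟩ := (Metric.tendsto_nhds.1 hlim (δ / 2) (half_pos hδ)).exists
    obtain ⟨b, hxb, hb⟩ := hlast _ (hu k) (δ / 2) (half_pos hδ)
    refine Relation.TransGen.tail' (Relation.ReflTransGen.mono (fun p q h =>
      ⟨h.1, h.2.1, h.2.2.1, h.2.2.2.trans (half_lt_self hδ)⟩) _ _ hxb) ⟨hb.1, hyM, fun h0 => ?_, ?_⟩
    · have hx0 : x ∈ M0 := apLe_M0 (hu k).2.2 (hb.2.2.1 h0)
      exact hM0cl.mem_of_tendsto hlim (Eventually.of_forall fun j => apLe_M0 (hu j).2.1 hx0)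
    · have := dist_triangle y (u k) (F b)
      have h2 := hb.2.2.2
      rw [dist_comm] at hk
      linarith
  · obtain ⟨C, hC⟩ := hFbdd
    refine (Metric.isBounded_closedBall (x := (0 : Fin d → ℝ)) (r := C + 1)).subset ?_
    intro y hy
    obtain ⟨b, -, hb⟩ := hlast y hy 1 one_pos
    have h1 := hC b hb.1
    have h2 := hb.2.2.2
    have h3 := dist_triangle y (F b) 0
    rw [dist_zero_right (F b)] at h3
    rw [mem_closedBall]
    linarith

end QSDPaper
end
end

section
/- Assume there are exactly v ap-basic classes K_1, …, K_v in M_1, all closed. Then: (a) for every sufficiently small θ > 0 there exists 0 < δ(θ) < θ such that if (ξ_0,…,ξ_n) is an ap δ(θ)-pseudoorbit with d(ξ_0, K_i) < δ(θ), d(ξ_j, K_i) > θ for some j ∈ {1,…,n}, and d(ξ_n, K_{i'}) < δ(θ) for some i, i' ∈ {1,…,v}, then i ≠ i' and K_i <_ap K_{i'}; (b) for every δ' > 0 there exist δ ∈ (0, δ') and n_0 ≥ 1 such that every ap δ-pseudoorbit of length at least n_0 passes through N^{δ'}(R_ap). -/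
open MeasureTheory ProbabilityTheory Metric Set Filter Topology
open scoped ENNReal NNReal

noncomputable section

namespace QSDPaper

variable {d : ℕ}

section helpers

variable {F : (Fin d → ℝ) → Fin d → ℝ} {M M0 : Set (Fin d → ℝ)}

lemma orbit_stay {δ : ℝ} {n : ℕ} {ξ : ℕ → Fin d → ℝ} (h : IsApOrbit F M M0 δ n ξ)
    {i : ℕ} (hi : i ≤ n) (h0 : ξ i ∈ M0) : ∀ k, i + k ≤ n → ξ (i + k) ∈ M0 := by
  intro k
  induction k with
  | zero => intro _; exact h0
  | succ k ih =>
    intro hk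
    exact h.2.2.1 (i + k) (by omega) (ih (by omega))

lemma orbit_notMem {δ : ℝ} {n : ℕ} {ξ : ℕ → Fin d → ℝ} (h : IsApOrbit F M M0 δ n ξ)
    (hn : ξ n ∉ M0) : ∀ i ≤ n, ξ i ∉ M0 := by
  intro i hi h0
  have := orbit_stay h hi h0 (n - i) (by omega)
  rw [show i + (n - i) = n by omega] at this
  exact hn this

lemma apLe_trans {x y z : Fin d → ℝ} (h1 : apLe F M M0 x y) (h2 : apLe F M M0 y z) :
    apLe F M M0 x z := by
  intro δ hδ
  obtain ⟨n, ξ, ⟨hn, hM, h0, hd⟩, hx, hy⟩ := h1 δ hδ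
  obtain ⟨m, ζ, ⟨hm, hM', h0', hd'⟩, hx', hy'⟩ := h2 δ hδ
  refine ⟨n + m, fun i => if i ≤ n then ξ i else ζ (i - n), ⟨by omega, ?_, ?_, ?_⟩, ?_, ?_⟩
  · intro i hi
    dsimp only
    split_ifs with h
    · exact hM i h
    · exact hM' _ (by omega)
  · intro i hi
    dsimp only
    rcases lt_trichotomy i n with h | h | h
    · rw [if_pos h.le, if_pos (by omega)]; exact h0 i h
    · subst h
      rw [if_pos le_rfl, if_neg (by omega), hy, ← hx', show i + 1 - i = 0 + 1 by omega]
      exact h0' 0 (by omega)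
    · rw [if_neg (by omega), if_neg (by omega), show i + 1 - n = (i - n) + 1 by omega]
      exact h0' _ (by omega)
  · intro i hi
    dsimp only
    rcases lt_trichotomy i n with h | h | h
    · rw [if_pos h.le, if_pos (by omega)]; exact hd i h
    · subst h
      rw [if_pos le_rfl, if_neg (by omega), hy, ← hx', show i + 1 - i = 0 + 1 by omega]
      exact hd' 0 (by omega)
    · rw [if_neg (by omega), if_neg (by omega), show i + 1 - n = (i - n) + 1 by omega]
      exact hd' _ (by omega)
  · simp [hx]
  · dsimp only
    rw [if_neg (by omega), show n + m - n = m by omega, hy']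

lemma apLe_of_near (hM0cl : IsClosed M0) (hFcont : ContinuousOn F M)
    {x y : Fin d → ℝ} (hx : x ∈ M) (hy : y ∈ M) (hxy : x ∈ M0 ↔ y ∈ M0)
    (H : ∀ η > (0 : ℝ), ∃ n ξ, IsApOrbit F M M0 η n ξ ∧ dist (ξ 0) x < η ∧ dist (ξ n) y < η ∧
      (x ∈ M0 → ∀ i ≤ n, ξ i ∈ M0)) : apLe F M M0 x y := by
  intro δ hδ
  obtain ⟨r, hr, hrF⟩ := Metric.continuousOn_iff.1 hFcont x hx (δ / 3) (by positivity)
  obtain ⟨s, hs, hsy⟩ : ∃ s > (0 : ℝ), y ∉ M0 → ∀ u, dist u y < s → u ∉ M0 := by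
    by_cases hy0 : y ∈ M0
    · exact ⟨1, one_pos, fun h => absurd hy0 h⟩
    · obtain ⟨s, hs, h⟩ := Metric.isOpen_iff.1 hM0cl.isOpen_compl y hy0
      exact ⟨s, hs, fun _ u hu => h hu⟩
  obtain ⟨n, ξ, ho, h0, hn, hin⟩ := H (min (δ / 3) (min r s)) (by positivity)
  have hη1 : min (δ / 3) (min r s) ≤ δ / 3 := min_le_left _ _
  have hη2 : min (δ / 3) (min r s) ≤ r := (min_le_right _ _).trans (min_le_left _ _)
  have hη3 : min (δ / 3) (min r s) ≤ s := (min_le_right _ _).trans (min_le_right _ _)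
  set η := min (δ / 3) (min r s)
  have hn1 := ho.1
  let ζ : ℕ → Fin d → ℝ := fun i => if i = 0 then x else if i = n then y else ξ i
  have hζ0 : ζ 0 = x := by simp [ζ]
  have hζn : ζ n = y := by
    simp only [ζ]; rw [if_neg (by omega)]; simp
  have hζs : ∀ i, dist (ζ (i + 1)) (ξ (i + 1)) < δ / 3 := by
    intro i
    by_cases h : i + 1 = n
    · rw [h, hζn, dist_comm]; linarith
    · simp only [ζ]; rw [if_neg (by omega), if_neg h, dist_self]; positivity
  have hζF : ∀ i < n, dist (F (ξ i)) (F (ζ i)) < δ / 3 := by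
    intro i hi
    by_cases h : i = 0
    · subst h
      rw [hζ0]
      exact hrF _ (ho.2.1 0 (by omega)) (by linarith)
    · simp only [ζ]; rw [if_neg h, if_neg (by omega), dist_self]; positivity
  refine ⟨n, ζ, ⟨hn1, ?_, ?_, ?_⟩, hζ0, hζn⟩
  · intro i hi
    simp only [ζ]
    split_ifs
    · exact hx
    · exact hy
    · exact ho.2.1 i hi
  · intro i hi
    by_cases hx0 : x ∈ M0
    · intro _
      simp only [ζ]
      have hy0 : y ∈ M0 := hxy.1 hx0
      have hi0 : ξ (i + 1) ∈ M0 := hin hx0 _ (by omega)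
      split_ifs <;> assumption
    · intro hz
      exfalso
      have hyn : y ∉ M0 := fun h => hx0 (hxy.2 h)
      have hξn : ξ n ∉ M0 := hsy hyn _ (by linarith)
      have := orbit_notMem ho hξn i (by omega)
      simp only [ζ] at hz
      split_ifs at hz
      · exact hx0 hz
      · exact hyn hz
      · exact this hz
  · intro i hi
    have h1 := hζs i
    have h2 := hζF i hi
    have h3 := ho.2.2.2 i hi
    have := dist_triangle4 (ζ (i + 1)) (ξ (i + 1)) (F (ξ i)) (F (ζ i))
    linarith

lemma iterate_mem (hFmap : MapsTo F M M) {x : Fin d → ℝ} (hx : x ∈ M) (n : ℕ) : F^[n] x ∈ M :=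
  (hFmap.iterate n) hx

lemma exists_limit {C : ℝ} (hMcl : IsClosed M) (hFmap : MapsTo F M M)
    (hC : ∀ x ∈ M, ‖F x‖ ≤ C) {x : Fin d → ℝ} (hx : x ∈ M) :
    ∃ z ∈ M, ∃ φ : ℕ → ℕ, StrictMono φ ∧ Tendsto (fun k => F^[φ k] x) atTop (𝓝 z) := by
  have hc : IsCompact (closedBall (0 : Fin d → ℝ) C ∩ M) :=
    (isCompact_closedBall _ _).inter_right hMcl
  obtain ⟨z, hz, φ, hφ, ht⟩ := hc.tendsto_subseq (x := fun k => F^[k + 1] x) (by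
    intro k
    refine ⟨?_, iterate_mem hFmap hx _⟩
    rw [mem_closedBall_zero_iff, Function.iterate_succ_apply']
    exact hC _ (iterate_mem hFmap hx _))
  exact ⟨z, hz.2, fun k => φ k + 1, fun a b h => Nat.add_lt_add_right (hφ h) 1, ht⟩

lemma limit_rec (hM0cl : IsClosed M0) (hFmap : MapsTo F M M) (hFcont : ContinuousOn F M)
    (hFM0 : MapsTo F M0 M0) {x z : Fin d → ℝ} (hx : x ∈ M) (hz : z ∈ M)
    {φ : ℕ → ℕ} (hφ : StrictMono φ) (ht : Tendsto (fun k => F^[φ k] x) atTop (𝓝 z))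
    (hzx : z ∈ M0 → x ∈ M0) : z ∈ apRec F M M0 := by
  have key : apLe F M M0 z z := by
    refine apLe_of_near hM0cl hFcont hz hz Iff.rfl ?_
    intro η hη
    obtain ⟨N, hN⟩ := Metric.tendsto_atTop.1 ht η hη
    have hlt : φ N < φ (N + 1) := hφ (Nat.lt_succ_self N)
    refine ⟨φ (N + 1) - φ N, fun i => F^[φ N + i] x, ⟨by omega, ?_, ?_, ?_⟩, ?_, ?_, ?_⟩
    · intro i _; exact iterate_mem hFmap hx _
    · intro i _ h
      dsimp only at h ⊢
      rw [← add_assoc, Function.iterate_succ_apply']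
      exact hFM0 h
    · intro i _
      dsimp only
      rw [← add_assoc, Function.iterate_succ_apply', dist_self]
      exact hη
    · exact hN N le_rfl
    · dsimp only
      rw [show φ N + (φ (N + 1) - φ N) = φ (N + 1) by omega]
      exact hN (N + 1) (by omega)
    · intro h i _
      exact iterate_mem hFM0 (hzx h) _
  exact ⟨key, key⟩

lemma apRec_mem_M {x : Fin d → ℝ} (h : x ∈ apRec F M M0) : x ∈ M := by
  obtain ⟨n, ξ, ho, h0, _⟩ := h.1 1 one_pos
  rw [← h0]; exact ho.2.1 0 (by omega)

lemma apRec_norm {C : ℝ} (hC : ∀ x ∈ M, ‖F x‖ ≤ C) {x : Fin d → ℝ} (h : x ∈ apRec F M M0) :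
    ‖x‖ ≤ C + 1 := by
  obtain ⟨n, ξ, ho, _, h1⟩ := h.1 1 one_pos
  obtain ⟨m, rfl⟩ : ∃ m, n = m + 1 := ⟨n - 1, by have := ho.1; omega⟩
  have h2 := ho.2.2.2 m (by omega)
  rw [h1, dist_eq_norm] at h2
  have h3 := hC _ (ho.2.1 m (by omega))
  have := norm_add_le (x - F (ξ m)) (F (ξ m))
  rw [sub_add_cancel] at this
  linarith

/-- no full orbit avoids a neighbourhood of the recurrent set -/
lemma orbit_hits {C : ℝ} (hMcl : IsClosed M) (hM0cl : IsClosed M0) (hFmap : MapsTo F M M)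
    (hFcont : ContinuousOn F M) (hC : ∀ x ∈ M, ‖F x‖ ≤ C)
    (hFM0 : MapsTo F M0 M0) {δ : ℝ} (hδ : 0 < δ) {x : Fin d → ℝ} (hx : x ∈ M) :
    ∃ n, F^[n] x ∈ thickening δ (apRec F M M0) := by
  by_contra! hno
  have hcl : IsClosed (thickening δ (apRec F M M0))ᶜ := isOpen_thickening.isClosed_compl
  have hrec : ∀ z ∈ apRec F M M0, z ∉ (thickening δ (apRec F M M0))ᶜ := fun z hz h =>
    h (self_subset_thickening hδ _ hz)
  obtain ⟨z, hz, φ, hφ, ht⟩ := exists_limit hMcl hFmap hC hx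
  have hzT : z ∈ (thickening δ (apRec F M M0))ᶜ :=
    hcl.mem_of_tendsto ht (Eventually.of_forall fun k => hno _)
  by_cases h : z ∈ M0 → x ∈ M0
  · exact hrec z (limit_rec hM0cl hFmap hFcont hFM0 hx hz hφ ht h) hzT
  · push Not at h
    obtain ⟨y, hy, ψ, hψ, ht'⟩ := exists_limit hMcl hFmap hC hz
    have hyr : y ∈ apRec F M M0 := limit_rec hM0cl hFmap hFcont hFM0 hz hy hψ ht' (fun _ => h.1)
    refine hrec y hyr (hcl.mem_of_tendsto ht' (Eventually.of_forall fun k => ?_))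
    have hit : ContinuousOn (F^[ψ k]) M := hFcont.iterate hFmap (ψ k)
    have h1 : Tendsto (fun k => F^[φ k] x) atTop (𝓝[M] z) :=
      tendsto_nhdsWithin_iff.2 ⟨ht, Eventually.of_forall fun k => iterate_mem hFmap hx _⟩
    have h2 := (hit z hz).tendsto.comp h1
    refine hcl.mem_of_tendsto h2 (Eventually.of_forall fun l => ?_)
    simp only [Function.comp]
    rw [← Function.iterate_add_apply]
    exact hno _

lemma part_b {C : ℝ} (hMcl : IsClosed M) (hM0cl : IsClosed M0) (hFmap : MapsTo F M M)
    (hFcont : ContinuousOn F M) (hC : ∀ x ∈ M, ‖F x‖ ≤ C)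
    (hFM0 : MapsTo F M0 M0) :
    ∀ δ' > (0 : ℝ), ∃ δ, 0 < δ ∧ δ < δ' ∧ ∃ n₀ : ℕ, 1 ≤ n₀ ∧
      ∀ (n : ℕ) (ξ : ℕ → Fin d → ℝ), IsApOrbit F M M0 δ n ξ → n₀ ≤ n →
        ∃ j ≤ n, ξ j ∈ M ∩ thickening δ' (apRec F M M0) := by
  intro δ' hδ'
  by_contra! hno
  have hδ : ∀ k : ℕ, 0 < δ' / (k + 2) := fun k => by positivity
  have hδlt : ∀ k : ℕ, δ' / (k + 2) < δ' := fun k => by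
    rw [div_lt_iff₀ (by positivity)]
    have : (0 : ℝ) ≤ k := Nat.cast_nonneg k
    nlinarith
  choose n ξ ho hn hout using fun k : ℕ => hno _ (hδ k) (hδlt k) (k + 1) (by omega)
  have hδ0 : Tendsto (fun k : ℕ => δ' / ((k : ℝ) + 2)) atTop (𝓝 0) :=
    tendsto_const_nhds.div_atTop
      (tendsto_atTop_add_const_right _ _ tendsto_natCast_atTop_atTop)
  have hc : IsCompact (closedBall (0 : Fin d → ℝ) (C + δ') ∩ M) :=
    (isCompact_closedBall _ _).inter_right hMcl
  obtain ⟨w, hw, φ, hφ, ht⟩ := hc.tendsto_subseq (x := fun k => ξ k 1) (by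
    intro k
    refine ⟨?_, (ho k).2.1 1 (ho k).1⟩
    rw [mem_closedBall_zero_iff]
    have h2 := (ho k).2.2.2 0 (by have := (ho k).1; omega)
    have h3 := hC _ ((ho k).2.1 0 (by omega))
    rw [zero_add, dist_eq_norm] at h2
    have := norm_add_le (ξ k 1 - F (ξ k 0)) (F (ξ k 0))
    rw [sub_add_cancel] at this
    linarith [hδlt k])
  have hlim : ∀ i : ℕ, Tendsto (fun k => ξ (φ k) (i + 1)) atTop (𝓝 (F^[i] w)) := by
    intro i
    induction i with
    | zero => exact ht
    | succ i ih =>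
      have hev : ∀ᶠ k in atTop, i + 2 ≤ n (φ k) := by
        filter_upwards [eventually_ge_atTop (i + 2)] with k hk
        have := hφ.id_le k
        have := hn (φ k)
        simp only [id] at *
        omega
      have h1 : Tendsto (fun k => ξ (φ k) (i + 1)) atTop (𝓝[M] (F^[i] w)) :=
        tendsto_nhdsWithin_iff.2 ⟨ih, by
          filter_upwards [hev] with k hk
          exact (ho (φ k)).2.1 _ (by omega)⟩
      have h2 := (hFcont _ (iterate_mem hFmap hw.2 i)).tendsto.comp h1
      rw [Function.iterate_succ_apply']
      refine (tendsto_iff_of_dist ?_).2 h2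
      refine squeeze_zero' (Eventually.of_forall fun _ => dist_nonneg) ?_
        (hδ0.comp hφ.tendsto_atTop)
      filter_upwards [hev] with k hk
      exact ((ho (φ k)).2.2.2 (i + 1) (by omega)).le
  obtain ⟨i, hi⟩ := orbit_hits hMcl hM0cl hFmap hFcont hC hFM0 hδ' hw.2
  have h1 := (hlim i).eventually (isOpen_thickening.mem_nhds hi)
  obtain ⟨k, hk1, hk2⟩ := (h1.and (eventually_ge_atTop (i + 1))).exists
  have h3 : i + 1 ≤ n (φ k) := by
    have := hφ.id_le k
    have := hn (φ k)
    simp only [id] at *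
    omega
  exact hout (φ k) (i + 1) h3 ⟨(ho _).2.1 _ h3, hk1⟩

lemma part_a1 (hM0cl : IsClosed M0) (hFcont : ContinuousOn F M)
    {A B : Set (Fin d → ℝ)} (hA : IsCompact A) (hB : IsCompact B) (hAne : A.Nonempty)
    (hBne : B.Nonempty) (hAM : A ⊆ M \ M0) (hBM : B ⊆ M \ M0) (S : Prop)
    (hS : ∀ x ∈ A, ∀ y ∈ B, apLe F M M0 x y → S) :
    ∀ᶠ δ in 𝓝[>] (0 : ℝ), ∀ n ξ, IsApOrbit F M M0 δ n ξ → infDist (ξ 0) A < δ →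
      infDist (ξ n) B < δ → S := by
  by_contra hcon
  obtain ⟨δ, hδ, hP⟩ := exists_seq_forall_of_frequently (not_eventually.1 hcon)
  push Not at hP
  choose n ξ ho h0 hn hnS using hP
  choose p hp hpd using fun k => (infDist_lt_iff hAne).1 (h0 k)
  choose q hq hqd using fun k => (infDist_lt_iff hBne).1 (hn k)
  obtain ⟨⟨x, y⟩, ⟨hx, hy⟩, φ, hφ, ht⟩ := (hA.prod hB).tendsto_subseq
    (x := fun k => (p k, q k)) (fun k => ⟨hp k, hq k⟩)
  have hδ0 : Tendsto (fun k => δ (φ k)) atTop (𝓝 0) :=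
    (tendsto_nhds_of_tendsto_nhdsWithin hδ).comp hφ.tendsto_atTop
  have htp : Tendsto (fun k => p (φ k)) atTop (𝓝 x) := (continuous_fst.tendsto _).comp ht
  have htq : Tendsto (fun k => q (φ k)) atTop (𝓝 y) := (continuous_snd.tendsto _).comp ht
  refine hnS 0 (hS x hx y hy (apLe_of_near hM0cl hFcont (hAM hx).1 (hBM hy).1
    ⟨fun h => absurd h (hAM hx).2, fun h => absurd h (hBM hy).2⟩ ?_))
  intro η hη
  have e1 := hδ0.eventually (gt_mem_nhds (half_pos hη))
  have e2 := (Metric.tendsto_nhds.1 htp) _ (half_pos hη)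
  have e3 := (Metric.tendsto_nhds.1 htq) _ (half_pos hη)
  obtain ⟨k, k1, k2, k3⟩ := (e1.and (e2.and e3)).exists
  have o := ho (φ k)
  refine ⟨n (φ k), ξ (φ k), ⟨o.1, o.2.1, o.2.2.1, fun i hi => ?_⟩, ?_, ?_,
    fun h => absurd h (hAM hx).2⟩
  · linarith [o.2.2.2 i hi]
  · linarith [dist_triangle (ξ (φ k) 0) (p (φ k)) x, hpd (φ k)]
  · linarith [dist_triangle (ξ (φ k) (n (φ k))) (q (φ k)) y, hqd (φ k)]

lemma part_a2 (hMcl : IsClosed M) (hM0cl : IsClosed M0) (hFcont : ContinuousOn F M)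
    (hFM1 : MapsTo F (M \ M0) (M \ M0))
    {A : Set (Fin d → ℝ)} (hA : IsCompact A) (hAne : A.Nonempty)
    (hAM : A ⊆ M \ M0) {θ : ℝ} (hθ : 0 < θ) (hθM : ∀ w, infDist w A ≤ θ → w ∉ M0)
    (hS : ∀ x ∈ A, ∀ y ∈ A, ∀ z ∈ M \ M0, apLe F M M0 x z → apLe F M M0 z y → z ∈ A) :
    ∀ᶠ δ in 𝓝[>] (0 : ℝ), ∀ n ξ j, IsApOrbit F M M0 δ n ξ → infDist (ξ 0) A < δ →
      infDist (ξ n) A < δ → j ≤ n → θ < infDist (ξ j) A → False := by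
  by_contra hcon
  have hlt : ∀ᶠ δ in 𝓝[>] (0 : ℝ), δ < θ := nhdsWithin_le_nhds (gt_mem_nhds hθ)
  obtain ⟨δ, hδ, hP⟩ := exists_seq_forall_of_frequently
    ((not_eventually.1 hcon).and_eventually hlt)
  have hQ : ∀ k, ∃ n ξ m, IsApOrbit F M M0 (δ k) n ξ ∧ infDist (ξ 0) A < δ k ∧
      infDist (ξ n) A < δ k ∧ m + 1 < n ∧ infDist (ξ m) A ≤ θ ∧ θ < infDist (ξ (m + 1)) A := by
    intro k
    obtain ⟨h1, h2⟩ := hP k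
    push Not at h1
    obtain ⟨n, ξ, j, ho, h0, hn, hj, hjθ, -⟩ := h1
    have hex : ∃ j, θ < infDist (ξ j) A := ⟨j, hjθ⟩
    classical
    have hs := Nat.find_spec hex
    have hle : Nat.find hex ≤ j := Nat.find_min' hex hjθ
    have hne : Nat.find hex ≠ 0 := fun h => by rw [h] at hs; linarith
    have hne' : Nat.find hex ≠ n := fun h => by rw [h] at hs; linarith
    obtain ⟨m, hm⟩ := Nat.exists_eq_succ_of_ne_zero hne
    have hmin := Nat.find_min hex (m := m) (by omega)
    refine ⟨n, ξ, m, ho, h0, hn, by omega, not_lt.1 hmin, ?_⟩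
    rw [hm] at hs
    exact hs
  choose n ξ m ho h0 hn hmn hm hm1 using hQ
  choose p hp hpd using fun k => (infDist_lt_iff hAne).1 (h0 k)
  choose q hq hqd using fun k => (infDist_lt_iff hAne).1 (hn k)
  have hct : ∀ w, w ∈ cthickening θ A ↔ infDist w A ≤ θ := fun w => by
    rw [cthickening_eq_preimage_infEDist, infDist, mem_preimage, mem_Iic,
      ENNReal.le_ofReal_iff_toReal_le (infEDist_ne_top hAne) hθ.le]
  have hc : IsCompact (cthickening θ A ∩ M) := hA.cthickening.inter_right hMcl
  obtain ⟨⟨x, y, w⟩, ⟨hx, hy, hw⟩, φ, hφ, ht⟩ := (hA.prod (hA.prod hc)).tendsto_subseq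
    (x := fun k => (p k, q k, ξ k (m k))) (fun k => ⟨hp k, hq k, by
      exact (hct _).2 (hm k),
      (ho k).2.1 _ (by have := hmn k; omega)⟩)
  have hδ0 : Tendsto (fun k => δ (φ k)) atTop (𝓝 0) :=
    (tendsto_nhds_of_tendsto_nhdsWithin hδ).comp hφ.tendsto_atTop
  have htp : Tendsto (fun k => p (φ k)) atTop (𝓝 x) := (continuous_fst.tendsto _).comp ht
  have htq : Tendsto (fun k => q (φ k)) atTop (𝓝 y) :=
    ((continuous_fst.comp continuous_snd).tendsto _).comp ht
  have htw : Tendsto (fun k => ξ (φ k) (m (φ k))) atTop (𝓝 w) :=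
    ((continuous_snd.comp continuous_snd).tendsto _).comp ht
  have hwM : w ∈ M := hw.2
  have hw0 : w ∉ M0 := hθM w ((hct w).1 hw.1)
  have hz : F w ∈ M \ M0 := hFM1 ⟨hwM, hw0⟩
  have htz : Tendsto (fun k => ξ (φ k) (m (φ k) + 1)) atTop (𝓝 (F w)) := by
    have h1 : Tendsto (fun k => ξ (φ k) (m (φ k))) atTop (𝓝[M] w) :=
      tendsto_nhdsWithin_iff.2 ⟨htw, Eventually.of_forall fun k =>
        (ho (φ k)).2.1 _ (by have := hmn (φ k); omega)⟩
    have h2 := (hFcont _ hwM).tendsto.comp h1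
    refine (tendsto_iff_of_dist ?_).2 h2
    refine squeeze_zero (fun _ => dist_nonneg) (fun k => ?_) hδ0
    exact ((ho (φ k)).2.2.2 _ (by have := hmn (φ k); omega)).le
  have hzθ : θ ≤ infDist (F w) A :=
    ge_of_tendsto (((continuous_infDist_pt A).tendsto _).comp htz)
      (Eventually.of_forall fun k => (hm1 (φ k)).le)
  have hfin : ∀ η > (0 : ℝ), ∃ k, δ (φ k) < η / 2 ∧ dist (p (φ k)) x < η / 2 ∧
      dist (q (φ k)) y < η / 2 ∧ dist (ξ (φ k) (m (φ k) + 1)) (F w) < η := by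
    intro η hη
    have e1 := hδ0.eventually (gt_mem_nhds (half_pos hη))
    have e2 := (Metric.tendsto_nhds.1 htp) _ (half_pos hη)
    have e3 := (Metric.tendsto_nhds.1 htq) _ (half_pos hη)
    have e4 := (Metric.tendsto_nhds.1 htz) _ hη
    exact (e1.and (e2.and (e3.and e4))).exists
  have hxz : apLe F M M0 x (F w) := by
    refine apLe_of_near hM0cl hFcont (hAM hx).1 hz.1
      ⟨fun h => absurd h (hAM hx).2, fun h => absurd h hz.2⟩ ?_
    intro η hη
    obtain ⟨k, k1, k2, k3, k4⟩ := hfin η hη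
    have o := ho (φ k)
    have hmk := hmn (φ k)
    refine ⟨m (φ k) + 1, ξ (φ k), ⟨by omega, fun i hi => o.2.1 i (by omega),
      fun i hi => o.2.2.1 i (by omega), fun i hi => ?_⟩, ?_, k4,
      fun h => absurd h (hAM hx).2⟩
    · linarith [o.2.2.2 i (by omega)]
    · linarith [dist_triangle (ξ (φ k) 0) (p (φ k)) x, hpd (φ k)]
  have hzy : apLe F M M0 (F w) y := by
    refine apLe_of_near hM0cl hFcont hz.1 (hAM hy).1
      ⟨fun h => absurd h hz.2, fun h => absurd h (hAM hy).2⟩ ?_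
    intro η hη
    obtain ⟨k, k1, k2, k3, k4⟩ := hfin η hη
    have o := ho (φ k)
    have hmk := hmn (φ k)
    refine ⟨n (φ k) - (m (φ k) + 1), fun i => ξ (φ k) (m (φ k) + 1 + i), ⟨by omega,
      fun i hi => o.2.1 _ (by omega),
      fun i hi => o.2.2.1 (m (φ k) + 1 + i) (by omega), fun i hi => ?_⟩, k4, ?_,
      fun h => absurd h hz.2⟩
    · have := o.2.2.2 (m (φ k) + 1 + i) (by omega)
      rw [add_assoc _ i 1] at this
      dsimp only
      linarith
    · dsimp only
      rw [show m (φ k) + 1 + (n (φ k) - (m (φ k) + 1)) = n (φ k) by omega]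
      linarith [dist_triangle (ξ (φ k) (n (φ k))) (q (φ k)) y, hqd (φ k)]
  have := infDist_zero_of_mem (hS x hx y hy (F w) hz hxz hzy)
  linarith

end helpers

theorem stmt7 (d : ℕ) (M M0 : Set (Fin d → ℝ)) (F : (Fin d → ℝ) → Fin d → ℝ)
    (hMcl : IsClosed M) (hM0cl : IsClosed M0) (hM0M : M0 ⊆ M)
    (hFmap : MapsTo F M M) (hFcont : ContinuousOn F M)
    (hFbdd : ∃ C : ℝ, ∀ x ∈ M, ‖F x‖ ≤ C)
    (hFM0 : MapsTo F M0 M0) (hFM1 : MapsTo F (M \ M0) (M \ M0))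
    (v : ℕ) (K : Fin v → Set (Fin d → ℝ))
    (hKcl : ∀ i, IsClosed (K i)) (hKM1 : ∀ i, K i ⊆ M \ M0)
    (hKbasic : ∀ i, ∃ x, x ∈ apRec F M M0 ∧ x ∈ M \ M0 ∧ K i = apClass F M M0 x)
    (hKall : ∀ x, x ∈ apRec F M M0 → x ∈ M \ M0 → ∃ i, apClass F M M0 x = K i)
    (hKdisj : ∀ i j, i ≠ j → K i ≠ K j) :
    (∃ θ₀ > (0 : ℝ), ∀ θ, 0 < θ → θ < θ₀ → ∃ δθ, 0 < δθ ∧ δθ < θ ∧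
      ∀ (n : ℕ) (ξ : ℕ → Fin d → ℝ) (i i' : Fin v) (j : ℕ),
        IsApOrbit F M M0 δθ n ξ → infDist (ξ 0) (K i) < δθ →
        infDist (ξ n) (K i') < δθ → 1 ≤ j → j ≤ n → θ < infDist (ξ j) (K i) →
        i ≠ i' ∧ ∀ a ∈ K i, ∀ b ∈ K i', apLe F M M0 a b) ∧
    (∀ δ' > (0 : ℝ), ∃ δ, 0 < δ ∧ δ < δ' ∧ ∃ n₀ : ℕ, 1 ≤ n₀ ∧
      ∀ (n : ℕ) (ξ : ℕ → Fin d → ℝ), IsApOrbit F M M0 δ n ξ → n₀ ≤ n →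
        ∃ j ≤ n, ξ j ∈ M ∩ thickening δ' (apRec F M M0)) := by
  obtain ⟨C, hC⟩ := hFbdd
  refine ⟨?_, part_b hMcl hM0cl hFmap hFcont hC hFM0⟩
  have hKrec : ∀ i, ∀ x ∈ K i, x ∈ apRec F M M0 := by
    intro i x hx
    obtain ⟨a, -, -, ha⟩ := hKbasic i
    rw [ha] at hx
    exact hx.1
  have hKne : ∀ i, (K i).Nonempty := by
    intro i
    obtain ⟨a, ha1, -, ha⟩ := hKbasic i
    rw [ha]
    exact ⟨a, ha1, ha1⟩
  have hKle : ∀ i, ∀ x ∈ K i, ∀ y ∈ K i, apLe F M M0 x y := by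
    intro i x hx y hy
    obtain ⟨a, -, -, ha⟩ := hKbasic i
    rw [ha] at hx hy
    exact apLe_trans hx.2.2 hy.2.1
  have hKS : ∀ i, ∀ x ∈ K i, ∀ y ∈ K i, ∀ z ∈ M \ M0, apLe F M M0 x z → apLe F M M0 z y →
      z ∈ K i := by
    intro i x hx y hy z _ hxz hzy
    have hyx := hKle i y hy x hx
    obtain ⟨a, -, -, ha⟩ := hKbasic i
    rw [ha] at hx hy ⊢
    have hzz : apLe F M M0 z z := apLe_trans hzy (apLe_trans hyx hxz)
    exact ⟨⟨hzz, hzz⟩, apLe_trans hx.2.1 hxz, apLe_trans hzy hy.2.2⟩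
  have hKc : ∀ i, IsCompact (K i) := by
    intro i
    refine (isCompact_closedBall (0 : Fin d → ℝ) (C + 1)).of_isClosed_subset (hKcl i) ?_
    intro x hx
    rw [mem_closedBall_zero_iff]
    exact apRec_norm hC (hKrec i x hx)
  have hsep : ∃ θ₀ > (0 : ℝ), ∀ i w, infDist w (K i) < θ₀ → w ∉ M0 := by
    have hU : IsCompact (⋃ i, K i) := isCompact_iUnion hKc
    have hsub : (⋃ i, K i) ⊆ M0ᶜ := iUnion_subset fun i x hx => (hKM1 i hx).2
    obtain ⟨r, hr, hrs⟩ := hU.exists_thickening_subset_open hM0cl.isOpen_compl hsub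
    refine ⟨r, hr, fun i w hw => ?_⟩
    obtain ⟨y, hy, hyd⟩ := (infDist_lt_iff (hKne i)).1 hw
    exact hrs (mem_thickening_iff.2 ⟨y, mem_iUnion.2 ⟨i, hy⟩, hyd⟩)
  obtain ⟨θ₀, hθ₀, hsep⟩ := hsep
  refine ⟨θ₀, hθ₀, fun θ hθ hθlt => ?_⟩
  have e1 : ∀ᶠ δ in 𝓝[>] (0 : ℝ), ∀ i i', ∀ n ξ, IsApOrbit F M M0 δ n ξ →
      infDist (ξ 0) (K i) < δ → infDist (ξ n) (K i') < δ →
      ∀ a ∈ K i, ∀ b ∈ K i', apLe F M M0 a b := by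
    rw [eventually_all]; intro i
    rw [eventually_all]; intro i'
    refine part_a1 hM0cl hFcont (hKc i) (hKc i') (hKne i) (hKne i') (hKM1 i) (hKM1 i') _ ?_
    intro x hx y hy hxy a ha b hb
    exact apLe_trans (hKle i a ha x hx) (apLe_trans hxy (hKle i' y hy b hb))
  have e2 : ∀ᶠ δ in 𝓝[>] (0 : ℝ), ∀ i, ∀ n ξ j, IsApOrbit F M M0 δ n ξ →
      infDist (ξ 0) (K i) < δ → infDist (ξ n) (K i) < δ → j ≤ n → θ < infDist (ξ j) (K i) →
      False := by
    rw [eventually_all]; intro i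
    exact part_a2 hMcl hM0cl hFcont hFM1 (hKc i) (hKne i) (hKM1 i) hθ
      (fun w hw => hsep i w (by linarith)) (hKS i)
  have hlt : ∀ᶠ δ in 𝓝[>] (0 : ℝ), δ < θ := nhdsWithin_le_nhds (gt_mem_nhds hθ)
  have hpos : ∀ᶠ δ in 𝓝[>] (0 : ℝ), 0 < δ := eventually_mem_nhdsWithin
  obtain ⟨δ, h1, h2, h3, h4⟩ := (e1.and (e2.and (hlt.and hpos))).exists
  refine ⟨δ, h4, h3, fun n ξ i i' j ho hi hi' _ hj hjθ => ⟨?_, h1 i i' n ξ ho hi hi'⟩⟩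
  rintro rfl
  exact h2 i n ξ j ho hi hi' hj hjθ

end QSDPaper
end
end
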